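/- Let G be a residually finite group that is not virtually abelian, such that the intersection Φ_f(G) of all maximal finite-index subgroups of G has finite index in G. Then G is hereditarily just infinite if and only if Φ_f(G) is just infinite and Fin(G) is trivial. -/

import Mathlib

def ResiduallyFinite (G : Type*) [Group G] : Prop :=
  sInf {N : Subgroup G | N.Normal ∧ N.FiniteIndex} = ⊥

def JustInfinite (G : Type*) [Group G] : Prop :=
  Infinite G ∧ ResiduallyFinite G ∧
    ∀ N : Subgroup G, N.Normal → N ≠ ⊥ → N.FiniteIndex

def FinRadical (G : Type*) [Group G] : Set G :=
  { x | ∃ N : Subgroup G, N.Normal ∧ (N : Set G).Finite ∧ x ∈ N }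

def VirtuallyAbelian (G : Type*) [Group G] : Prop :=
  ∃ H : Subgroup G, H.FiniteIndex ∧ ∀ a b : H, a * b = b * a

def conjugatesSet (G : Type*) [Group G] (B : Subgroup G) : Set (Subgroup G) :=
  { C | ∃ g : G, B.map (MulAut.conj g).toMonoidHom = C }

def IsBasal (G : Type*) [Group G] (B : Subgroup G) : Prop :=
  B ≠ ⊥ ∧ (conjugatesSet G B).Finite ∧
  (∀ C ∈ conjugatesSet G B, ∀ D ∈ conjugatesSet G B, C ≠ D →
      C ⊓ D = ⊥ ∧ ∀ x ∈ C, ∀ y ∈ D, Commute x y) ∧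
  iSupIndep (fun C : conjugatesSet G B => (C : Subgroup G)) ∧
  (⨆ C ∈ conjugatesSet G B, C) = Subgroup.normalClosure (B : Set G)

theorem aux_fi {G : Type*} [Group G] (P N : Subgroup G) (hP : P.FiniteIndex)
    (h : (N.subgroupOf P).FiniteIndex) : N.FiniteIndex := by
  have h1 : (N ⊓ P).relIndex P * P.index = (N ⊓ P).index :=
    Subgroup.relIndex_mul_index inf_le_right
  have h2 : (N ⊓ P).FiniteIndex := by
    constructor
    rw [← h1, Subgroup.inf_relIndex_right]
    exact mul_ne_zero h.index_ne_zero hP.index_ne_zero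
  exact Subgroup.finiteIndex_of_le (inf_le_left : N ⊓ P ≤ N)

/-- centralizers of nontrivial elements have infinite index -/
theorem aux_cent {G : Type*} [Group G] (hnva : ¬ VirtuallyAbelian G)
    (hJ : ∀ N : Subgroup G, N.Normal → N ≠ ⊥ → N.FiniteIndex)
    (x : G) (hx : x ≠ 1) (D : Subgroup G) (hD : D.FiniteIndex)
    (hc : ∀ d ∈ D, d * x = x * d) : False := by
  apply hnva
  have hZ : D.normalCore.FiniteIndex := inferInstance
  have hN : (Subgroup.normalClosure {x}).FiniteIndex := by
    apply hJ _ inferInstance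
    intro h
    apply hx
    have : x ∈ Subgroup.normalClosure {x} := Subgroup.subset_normalClosure rfl
    rw [h] at this
    simpa using this
  have hle : Subgroup.normalClosure {x} ≤ Subgroup.centralizer (D.normalCore : Set G) := by
    apply Subgroup.normalClosure_le_normal
    intro y hy
    rw [Set.mem_singleton_iff] at hy
    subst hy
    rw [SetLike.mem_coe, Subgroup.mem_centralizer_iff]
    intro d hd
    exact hc d (Subgroup.normalCore_le D hd)
  refine ⟨Subgroup.normalClosure {x} ⊓ D.normalCore, inferInstance, ?_⟩
  rintro ⟨a, ha⟩ ⟨b, hb⟩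
  have := (Subgroup.mem_centralizer_iff.1 (hle ha.1)) b hb.2
  ext
  exact this.symm

/-- nontrivial subgroups normalised by a finite index subgroup meet finite index subgroups -/
theorem aux_meet {G : Type*} [Group G] (hnva : ¬ VirtuallyAbelian G)
    (hJ : ∀ N : Subgroup G, N.Normal → N ≠ ⊥ → N.FiniteIndex)
    (B K H : Subgroup G) (hK : K.FiniteIndex) (hH : H.FiniteIndex)
    (hB : ∃ x ∈ B, x ≠ 1) (hBK : ∀ k ∈ K, ∀ x ∈ B, k * x * k⁻¹ ∈ B) :
    ∃ x ∈ B, x ∈ H ∧ x ≠ 1 := by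
  by_contra! hcon
  obtain ⟨x, hxB, hx⟩ := hB
  refine aux_cent hnva hJ x hx (K ⊓ H.normalCore) inferInstance ?_
  rintro d ⟨hdK, hdH⟩
  have h1 : d * x * d⁻¹ * x⁻¹ ∈ B := B.mul_mem (hBK d hdK x hxB) (B.inv_mem hxB)
  have h2 : d * x * d⁻¹ * x⁻¹ ∈ H.normalCore := by
    have : d * (x * d⁻¹ * x⁻¹) ∈ H.normalCore :=
      H.normalCore.mul_mem hdH
        ((inferInstance : H.normalCore.Normal).conj_mem _ (H.normalCore.inv_mem hdH) x)
    simpa [mul_assoc] using this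
  have h3 := hcon _ h1 (Subgroup.normalCore_le H h2)
  have h4 : d * x * d⁻¹ = x := by rwa [mul_inv_eq_one] at h3
  rwa [mul_inv_eq_iff_eq_mul] at h4

theorem aux_coatom {G : Type*} [Group G] (N : Subgroup G) (hN : N.FiniteIndex) (hne : N ≠ ⊤) :
    ∃ M : Subgroup G, N ≤ M ∧ IsCoatom M ∧ M.FiniteIndex := by
  classical
  have hex : ∃ n, ∃ M : Subgroup G, N ≤ M ∧ M ≠ ⊤ ∧ M.index = n := ⟨_, N, le_rfl, hne, rfl⟩
  obtain ⟨M, hNM, hM, hn⟩ := Nat.find_spec hex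
  have hMf : M.FiniteIndex := Subgroup.finiteIndex_of_le hNM
  refine ⟨M, hNM, ⟨hM, ?_⟩, hMf⟩
  intro M' hlt
  by_contra hM'
  have h1 : M'.index < M.index := Subgroup.index_strictAnti hlt
  rw [hn] at h1
  exact Nat.find_min hex h1 ⟨M', hNM.trans hlt.le, hM', rfl⟩

/-- Wilson's construction -/
theorem aux_basal {G : Type*} [Group G] (K L : Subgroup G) (hKn : K.Normal) (hK : K.FiniteIndex)
    (hLK : L ≤ K) (hL : ∃ x ∈ L, x ≠ 1) (hLn : ∀ k ∈ K, ∀ x ∈ L, k * x * k⁻¹ ∈ L) :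
    ∃ B : Subgroup G, B ≤ K ∧ (∃ x ∈ B, x ≠ 1) ∧ (∀ k ∈ K, ∀ x ∈ B, k * x * k⁻¹ ∈ B) ∧
      (∃ g : G, ∀ x ∈ B, g⁻¹ * x * g ∈ L) ∧
      (∀ g : G, (∃ x ∈ B, g⁻¹ * x * g ∈ B ∧ x ≠ 1) → ∀ x, x ∈ B ↔ g⁻¹ * x * g ∈ B) := by
  classical
  have : Fintype (G ⧸ K) := Fintype.ofFinite _
  let I : Finset (G ⧸ K) → Subgroup G := fun S =>
    ⨅ g : {g : G // (g : G ⧸ K) ∈ S}, L.comap (MulAut.conj (g : G)⁻¹).toMonoidHom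
  have hI : ∀ S x, x ∈ I S ↔ ∀ g : G, (g : G ⧸ K) ∈ S → g⁻¹ * x * g ∈ L := by
    intro S x
    simp [I, Subgroup.mem_iInf]
  let F : Finset (Finset (G ⧸ K)) := Finset.univ.filter fun S => ∃ x ∈ I S, x ≠ 1
  have h1F : {((1 : G) : G ⧸ K)} ∈ F := by
    simp only [F, Finset.mem_filter, Finset.mem_univ, true_and]
    obtain ⟨x, hxL, hx⟩ := hL
    refine ⟨x, ?_, hx⟩
    rw [hI]
    intro g hg
    rw [Finset.mem_singleton] at hg
    have hg' : g ∈ K := (QuotientGroup.eq_one_iff g).1 hg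
    simpa using hLn g⁻¹ (K.inv_mem hg') x hxL
  obtain ⟨S, hSF, hmax⟩ := F.exists_max_image Finset.card ⟨_, h1F⟩
  have hSne : S.Nonempty := by
    rw [← Finset.card_pos]
    have := hmax _ h1F
    simp at this
    simpa using this
  obtain ⟨q, hq⟩ := hSne
  obtain ⟨g0, rfl⟩ := QuotientGroup.mk_surjective q
  have hb : ∀ x ∈ I S, g0⁻¹ * x * g0 ∈ L := fun x hx => (hI S x).1 hx g0 hq
  refine ⟨I S, ?_, by simpa [F] using hSF, ?_, ⟨g0, hb⟩, ?_⟩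
  · intro x hx
    have := hKn.conj_mem _ (hLK (hb x hx)) g0
    simpa [mul_assoc] using this
  · intro k hk x hx
    rw [hI] at hx ⊢
    intro g hg
    have h1 := hKn.conj_mem k hk g⁻¹
    have h2 := hLn _ h1 _ (hx g hg)
    simpa [mul_assoc] using h2
  · rintro g ⟨x, hx, hgx, hx1⟩
    let T : Finset (G ⧸ K) := S.image fun q => g • q
    have hT : ∀ y, y ∈ I T ↔ g⁻¹ * y * g ∈ I S := by
      intro y
      rw [hI, hI]
      constructor
      · intro h a ha
        have := h (g * a) (Finset.mem_image.2 ⟨_, ha, rfl⟩)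
        simpa [mul_assoc] using this
      · intro h a ha
        obtain ⟨q, hq, hqa⟩ := Finset.mem_image.1 ha
        have hq' : ((g⁻¹ * a : G) : G ⧸ K) ∈ S := by
          have : ((g⁻¹ * a : G) : G ⧸ K) = g⁻¹ • (a : G ⧸ K) := rfl
          rw [this, ← hqa, inv_smul_smul]
          exact hq
        have := h _ hq'
        simpa [mul_assoc] using this
    have hcard : T.card = S.card := Finset.card_image_of_injective _ (MulAction.injective g)
    have hU : S ∪ T ∈ F := by
      simp only [F, Finset.mem_filter, Finset.mem_univ, true_and]
      refine ⟨x, ?_, hx1⟩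
      rw [hI]
      intro a ha
      rcases Finset.mem_union.1 ha with h | h
      · exact (hI S x).1 hx a h
      · exact (hI T x).1 ((hT x).2 hgx) a h
    have hle := hmax _ hU
    have e1 : S = S ∪ T := Finset.eq_of_subset_of_card_le Finset.subset_union_left hle
    have e2 : T = S ∪ T :=
      Finset.eq_of_subset_of_card_le Finset.subset_union_right (hcard ▸ hle)
    have e3 : T = S := e2.trans e1.symm
    intro y
    rw [← hT, e3]

theorem aux_main {G : Type*} [Group G] (hnva : ¬ VirtuallyAbelian G)
    (hJ : ∀ N : Subgroup G, N.Normal → N ≠ ⊥ → N.FiniteIndex)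
    (P : Subgroup G) (hP : P.FiniteIndex)
    (hPle : ∀ M : Subgroup G, IsCoatom M → M.FiniteIndex → P ≤ M)
    (hPJ : ∀ N : Subgroup P, N.Normal → N ≠ ⊥ → N.FiniteIndex)
    (K L : Subgroup G) (hKn : K.Normal) (hK : K.FiniteIndex)
    (hLK : L ≤ K) (hL : ∃ x ∈ L, x ≠ 1) (hLn : ∀ k ∈ K, ∀ x ∈ L, k * x * k⁻¹ ∈ L) :
    L.FiniteIndex := by
  obtain ⟨B, hBK, hB1, hBn, ⟨g0, hg0⟩, hBc⟩ := aux_basal K L hKn hK hLK hL hLn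
  by_cases hnorm : B.Normal
  · have hBf : B.FiniteIndex := by
      apply hJ B hnorm
      rintro rfl
      obtain ⟨x, hx, hx1⟩ := hB1
      exact hx1 (by simpa using hx)
    refine Subgroup.finiteIndex_of_le (H := B) ?_
    intro x hx
    have := hg0 _ (hnorm.conj_mem x hx g0)
    simpa [mul_assoc] using this
  exfalso
  have hmemN : ∀ g : G, (∀ x, x ∈ B ↔ g⁻¹ * x * g ∈ B) → g ∈ Subgroup.normalizer (B : Set G) := by
    intro g h
    rw [← inv_mem_iff, Subgroup.mem_normalizer_iff]
    intro x
    simpa using h x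
  have hKN : K ≤ Subgroup.normalizer (B : Set G) := by
    intro k hk
    rw [Subgroup.mem_normalizer_iff]
    intro x
    refine ⟨hBn k hk x, fun h => ?_⟩
    have := hBn k⁻¹ (K.inv_mem hk) _ h
    simpa [mul_assoc] using this
  have hNf : (Subgroup.normalizer (B : Set G)).FiniteIndex := Subgroup.finiteIndex_of_le hKN
  have hNt : Subgroup.normalizer (B : Set G) ≠ ⊤ := fun h => hnorm (Subgroup.normalizer_eq_top_iff.1 h)
  obtain ⟨M, hNM, hMc, hMf⟩ := aux_coatom _ hNf hNt
  have hPM := hPle M hMc hMf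
  obtain ⟨g, hg⟩ : ∃ g, g ∉ M := by
    by_contra! h
    exact hMc.1 (Subgroup.eq_top_iff' M |>.2 h)
  -- the conjugates of B under P commute with g B g⁻¹
  have hcomm : ∀ h ∈ P, ∀ b ∈ B, ∀ c ∈ B,
      (g * c * g⁻¹) * (h * b * h⁻¹) = (h * b * h⁻¹) * (g * c * g⁻¹) := by
    intro h hh b hb c hc
    have hbK : h * b * h⁻¹ ∈ K := hKn.conj_mem _ (hBK hb) h
    have hcK : g * c * g⁻¹ ∈ K := hKn.conj_mem _ (hBK hc) g
    have conjn : ∀ a : G, ∀ k ∈ K, ∀ y, a⁻¹ * y * a ∈ B → a⁻¹ * (k * y * k⁻¹) * a ∈ B := by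
      intro a k hk y hy
      have h1 := hKn.conj_mem k hk a⁻¹
      have h2 := hBn _ h1 _ hy
      simpa [mul_assoc] using h2
    by_contra hne
    set u := g * c * g⁻¹ with hu
    set v := h * b * h⁻¹ with hv
    have hub : g⁻¹ * u * g ∈ B := by simpa [hu, mul_assoc] using hc
    have hvb : h⁻¹ * v * h ∈ B := by simpa [hv, mul_assoc] using hb
    let w := u * v * u⁻¹ * v⁻¹
    have hw1 : w ≠ 1 := by
      intro h
      apply hne
      rw [mul_inv_eq_one, mul_inv_eq_iff_eq_mul] at h
      exact h
    have hwh : h⁻¹ * w * h ∈ B := by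
      have := B.mul_mem (conjn h u hcK v hvb) (B.inv_mem hvb)
      simpa [w, mul_assoc] using this
    have hwg : g⁻¹ * w * g ∈ B := by
      have := B.mul_mem hub (conjn g v hbK u⁻¹ (by simpa [mul_assoc] using B.inv_mem hub))
      simpa [w, mul_assoc] using this
    have := hBc (h⁻¹ * g) ⟨h⁻¹ * w * h, hwh, by simpa [mul_assoc] using hwg, by
      intro h'
      apply hw1
      have : w = h * (h⁻¹ * w * h) * h⁻¹ := by group
      rw [this, h']; simp⟩
    have hM1 := hNM (hmemN _ this)
    apply hg
    have := M.mul_mem (hPM hh) hM1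
    simpa using this
  let D : Subgroup G := Subgroup.centralizer {y | ∃ h ∈ P, ∃ b ∈ B, y = h * b * h⁻¹}
  have hDmem : ∀ x, x ∈ D ↔ ∀ h ∈ P, ∀ b ∈ B, (h * b * h⁻¹) * x = x * (h * b * h⁻¹) := by
    intro x
    rw [Subgroup.mem_centralizer_iff]
    constructor
    · intro H h hh b hb
      exact H _ ⟨h, hh, b, hb, rfl⟩
    · rintro H _ ⟨h, hh, b, hb, rfl⟩
      exact H h hh b hb
  -- a nontrivial element
  obtain ⟨z, hz, hzP, hz1⟩ : ∃ z, g⁻¹ * z * g ∈ B ∧ z ∈ P ∧ z ≠ 1 := by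
    have := aux_meet hnva hJ (B.comap (MulAut.conj g⁻¹).toMonoidHom) K P hK hP
      (by
        obtain ⟨x, hx, hx1⟩ := hB1
        refine ⟨g * x * g⁻¹, by simpa [mul_assoc] using hx, ?_⟩
        intro h
        apply hx1
        rwa [mul_inv_eq_one, mul_eq_left] at h)
      (by
        intro k hk x hx
        have h1 := hKn.conj_mem k hk g⁻¹
        have h2 := hBn _ h1 _ (by simpa using hx : g⁻¹ * x * g ∈ B)
        simpa [mul_assoc] using h2)
    obtain ⟨z, h1, h2, h3⟩ := this
    exact ⟨z, by simpa using h1, h2, h3⟩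
  have hzD : z ∈ D := by
    rw [hDmem]
    intro h hh b hb
    have := hcomm h hh b hb _ hz
    have e : g * (g⁻¹ * z * g) * g⁻¹ = z := by group
    rw [e] at this
    exact this.symm
  have hDf : D.FiniteIndex := by
    apply aux_fi P D hP
    apply hPJ
    · constructor
      rintro ⟨n, hnP⟩ hn ⟨p, hp⟩
      rw [Subgroup.mem_subgroupOf] at hn ⊢
      rw [hDmem] at hn ⊢
      intro h hh b hb
      have := hn (p⁻¹ * h) (P.mul_mem (P.inv_mem hp) hh) b hb
      have h2 := congrArg (fun t => p * t * p⁻¹) this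
      simpa [mul_assoc] using h2
    · intro h
      have : (⟨z, hzP⟩ : P) ∈ D.subgroupOf P := hzD
      rw [h, Subgroup.mem_bot] at this
      exact hz1 (congrArg Subtype.val this)
  obtain ⟨x, hx, hx1⟩ := hB1
  refine aux_cent hnva hJ x hx1 D hDf ?_
  intro d hd
  have := (hDmem d).1 hd 1 P.one_mem x hx
  simpa using this.symm

theorem aux_rf {G : Type*} [Group G] (hrf : ResiduallyFinite G) (K : Subgroup G) :
    ResiduallyFinite K := by
  unfold ResiduallyFinite at *
  rw [eq_bot_iff]
  intro x hx
  rw [Subgroup.mem_sInf] at hx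
  have : (x : G) ∈ sInf {N : Subgroup G | N.Normal ∧ N.FiniteIndex} := by
    rw [Subgroup.mem_sInf]
    rintro N ⟨h1, h2⟩
    exact hx (N.subgroupOf K) ⟨inferInstance, inferInstance⟩
  rw [hrf, Subgroup.mem_bot] at this
  rw [Subgroup.mem_bot]
  exact Subtype.ext this

theorem hereditarilyJustInfinite_iff_frattini {G : Type*} [Group G]
    (hrf : ResiduallyFinite G) (hnva : ¬ VirtuallyAbelian G)
    (hfi : (sInf {M : Subgroup G | IsCoatom M ∧ M.FiniteIndex}).FiniteIndex) :
    (∀ K : Subgroup G, K.FiniteIndex → JustInfinite K) ↔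
      (JustInfinite ↥(sInf {M : Subgroup G | IsCoatom M ∧ M.FiniteIndex}) ∧
        FinRadical G = {1}) := by
  constructor
  · intro H
    refine ⟨H _ hfi, ?_⟩
    obtain ⟨hinf, -, hJ⟩ := H ⊤ inferInstance
    have hG : Infinite G := Infinite.of_injective _ (Subtype.val_injective (p := (· ∈ (⊤ : Subgroup G))))
    ext x
    rw [Set.mem_singleton_iff]
    constructor
    · rintro ⟨N, hN, hfin, hx⟩
      by_contra hx1
      have h1 : (N.subgroupOf ⊤).FiniteIndex := by
        apply hJ _ inferInstance
        intro h
        have : (⟨x, trivial⟩ : (⊤ : Subgroup G)) ∈ N.subgroupOf ⊤ := hx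
        rw [h, Subgroup.mem_bot] at this
        exact hx1 (congrArg Subtype.val this)
      have h2 : N.FiniteIndex := aux_fi ⊤ N inferInstance h1
      have h3 : Finite N := hfin
      have h4 := N.card_mul_index
      have h5 : Nat.card G ≠ 0 := by
        rw [← h4]
        exact mul_ne_zero Nat.card_pos.ne' h2.index_ne_zero
      exact h5 (Nat.card_eq_zero_of_infinite)
    · rintro rfl
      exact ⟨⊥, inferInstance, by simp, Subgroup.one_mem _⟩
  · rintro ⟨⟨hinf, -, hPJ⟩, hFin⟩
    set P := sInf {M : Subgroup G | IsCoatom M ∧ M.FiniteIndex} with hPdef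
    have hG : Infinite G := Infinite.of_injective _ (Subtype.val_injective (p := (· ∈ P)))
    have hJ : ∀ N : Subgroup G, N.Normal → N ≠ ⊥ → N.FiniteIndex := by
      intro N hN hne
      apply aux_fi P N hfi
      apply hPJ _ inferInstance
      intro h
      apply hne
      have hinj : Function.Injective (fun n : N => ((n : G) : G ⧸ P)) := by
        rintro ⟨a, ha⟩ ⟨b, hb⟩ hab
        have h1 : a⁻¹ * b ∈ P := QuotientGroup.eq.1 hab
        have : (⟨a⁻¹ * b, h1⟩ : P) ∈ N.subgroupOf P := N.mul_mem (N.inv_mem ha) hb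
        rw [h, Subgroup.mem_bot] at this
        have := congrArg Subtype.val this
        simp only [Subgroup.coe_one] at this
        rw [inv_mul_eq_one] at this
        exact Subtype.ext this
      have hNf : Finite N := Finite.of_injective _ hinj
      rw [eq_bot_iff]
      intro x hx
      have : x ∈ FinRadical G := ⟨N, hN, hNf, hx⟩
      rw [hFin] at this
      simpa using this
    intro K hK
    refine ⟨?_, aux_rf hrf K, ?_⟩
    · by_contra h
      rw [not_infinite_iff_finite] at h
      have h4 := K.card_mul_index
      rw [Nat.card_eq_zero_of_infinite (α := G)] at h4
      exact mul_ne_zero Nat.card_pos.ne' hK.index_ne_zero h4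
    · intro L hLn hL
      let L' := L.map K.subtype
      have hL'n : ∀ k ∈ K, ∀ x ∈ L', k * x * k⁻¹ ∈ L' := by
        rintro k hk _ ⟨x, hx, rfl⟩
        exact ⟨⟨k, hk⟩ * x * ⟨k, hk⟩⁻¹, hLn.conj_mem x hx ⟨k, hk⟩, rfl⟩
      have hL'1 : ∃ x ∈ L', x ≠ 1 := by
        obtain ⟨⟨x, hx⟩, hx0⟩ := Subgroup.ne_bot_iff_exists_ne_one.1 hL
        have hx1 : x ≠ 1 := fun h => hx0 (Subtype.ext h)
        exact ⟨x, ⟨x, hx, rfl⟩, fun h => hx1 (Subtype.ext h)⟩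
      obtain ⟨y, hy, hyK, hy1⟩ := aux_meet hnva hJ L' K K.normalCore hK inferInstance hL'1 hL'n
      have key := aux_main hnva hJ P hfi (fun M h1 h2 => sInf_le ⟨h1, h2⟩) hPJ K.normalCore
        (L' ⊓ K.normalCore) inferInstance inferInstance inf_le_right ⟨y, ⟨hy, hyK⟩, hy1⟩
        (fun k hk x hx => ⟨hL'n k (Subgroup.normalCore_le K hk) x hx.1,
          (inferInstance : K.normalCore.Normal).conj_mem _ hx.2 k⟩)
      have h2 : L'.FiniteIndex := Subgroup.finiteIndex_of_le (inf_le_left : L' ⊓ K.normalCore ≤ L')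
      have h3 : L'.subgroupOf K = L := Subgroup.comap_map_eq_self_of_injective
        K.subtype_injective L
      rw [← h3]
      infer_instance
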